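/- arXiv:math/0404022 — 3 statements merged into one kernel-verified Lean document; each statement's English description precedes it below -/
import Mathlib

section
/- Let E be a number field, p an odd prime, s ≥ 1, and P_1,…,P_s pairwise distinct maximal ideals of 𝒪_E, each of norm p. Let u_1,…,u_s be units of 𝒪_E with u_i ≡ 1 mod P_1⋯P_s for all i. Then there exist units u_1',…,u_s' of 𝒪_E such that u_1 ∧ ⋯ ∧ u_s = u_1' ∧ ⋯ ∧ u_s' in ⋀^s_ℤ(𝒪_E^×), and for each 1 ≤ k ≤ s the unit u_k' satisfies u_k' ≡ 1 mod P_1 · (∏_{j=2}^{s+1−k} P_j²) · (∏_{j=s+2−k}^{s} P_j); in particular u_1' ≡ 1 mod P_1 P_2² ⋯ P_s² and u_s' ≡ 1 mod P_1 P_2 ⋯ P_s. -/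
namespace ExteriorAlgebra

variable {A : Type*} [AddCommGroup A]

theorem ιMulti_succ_last (n : ℕ) (v : Fin (n + 1) → A) :
    ιMulti ℤ (n + 1) v = ιMulti ℤ n (fun i => v i.castSucc) * ι ℤ (v (Fin.last n)) := by
  rw [ιMulti_apply, ιMulti_apply, List.ofFn_succ', List.concat_eq_append, List.prod_append,
    List.prod_singleton]

theorem ιMulti_update_add_zsmul {n : ℕ} (v : Fin n → A) {i j : Fin n} (hij : i ≠ j) (c : ℤ) :
    ιMulti ℤ n (Function.update v i (v i + c • v j)) = ιMulti ℤ n v := by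
  rw [AlternatingMap.map_update_add, AlternatingMap.map_update_smul,
    AlternatingMap.map_update_self _ _ hij, Function.update_eq_self, smul_zero, add_zero]

/-- One pivoting step: if `K` is reached from `H` by adding multiples of any element of `H` outside
`K`, then all but the last vector of a family in `H` can be moved into `K`
without changing the wedge product. -/
theorem exists_ιMulti_eq_castSucc_mem {H K : AddSubgroup A}
    (hK : ∀ a ∈ H, ∀ b ∈ H, b ∉ K → ∃ c : ℤ, a + c • b ∈ K)
    {n : ℕ} (u : Fin (n + 1) → A) (hu : ∀ i, u i ∈ H) :
    ∃ w : Fin (n + 1) → A, ιMulti ℤ (n + 1) u = ιMulti ℤ (n + 1) w ∧ (∀ i, w i ∈ H) ∧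
      ∀ i : Fin n, w i.castSucc ∈ K := by
  wlog hlast : u (Fin.last n) ∉ K generalizing u
  · rw [not_not] at hlast
    by_cases hall : ∀ i : Fin n, u i.castSucc ∈ K
    · exact ⟨u, rfl, hu, hall⟩
    obtain ⟨i, hi⟩ := not_forall.mp hall
    have hne : Fin.last n ≠ i.castSucc := (Fin.castSucc_lt_last i).ne'
    rw [← ιMulti_update_add_zsmul u hne 1]
    refine this _ (fun k => ?_) ?_
    · rcases eq_or_ne k (Fin.last n) with rfl | hk
      · simpa using H.add_mem (hu _) (hu _)
      · simpa [Function.update_of_ne hk] using hu k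
    · simpa [K.add_mem_cancel_left hlast] using hi
  suffices h : ∀ S : Finset (Fin n), ∃ w : Fin (n + 1) → A,
      ιMulti ℤ (n + 1) u = ιMulti ℤ (n + 1) w ∧ (∀ i, w i ∈ H) ∧ w (Fin.last n) ∉ K ∧
        ∀ i ∈ S, w i.castSucc ∈ K by
    obtain ⟨w, h1, h2, -, h3⟩ := h Finset.univ
    exact ⟨w, h1, h2, fun i => h3 i (Finset.mem_univ i)⟩
  intro S
  induction S using Finset.induction_on with
  | empty => exact ⟨u, rfl, hu, hlast, by simp⟩
  | insert a S _ ih =>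
    obtain ⟨w, h1, h2, h3, h4⟩ := ih
    obtain ⟨c, hc⟩ := hK _ (h2 a.castSucc) _ (h2 (Fin.last n)) h3
    have hne : a.castSucc ≠ Fin.last n := (Fin.castSucc_lt_last a).ne
    refine ⟨Function.update w a.castSucc (w a.castSucc + c • w (Fin.last n)),
      by rw [ιMulti_update_add_zsmul w hne, h1], fun k => ?_, ?_, fun k hk => ?_⟩
    · rcases eq_or_ne k a.castSucc with rfl | hk
      · simpa using H.add_mem (h2 _) (H.zsmul_mem (h2 _) c)
      · simpa [Function.update_of_ne hk] using h2 k
    · rwa [Function.update_of_ne hne.symm]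
    · rcases eq_or_ne k a with rfl | hka
      · simpa using hc
      · rw [Function.update_of_ne fun h => hka (Fin.castSucc_injective n h)]
        exact h4 k ((Finset.mem_insert.mp hk).resolve_left hka)

theorem exists_ιMulti_eq_triangular {n : ℕ} (H : AddSubgroup A) (K : ℕ → AddSubgroup A)
    (hK : ∀ j, ∀ a ∈ H, ∀ b ∈ H, b ∉ K j → ∃ c : ℤ, a + c • b ∈ K j)
    (u : Fin n → A) (hu : ∀ i, u i ∈ H) :
    ∃ w : Fin n → A, ιMulti ℤ n u = ιMulti ℤ n w ∧ (∀ i, w i ∈ H) ∧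
      ∀ (i : Fin n) (j : ℕ), j + i + 1 < n → w i ∈ K j := by
  induction n generalizing H K with
  | zero => exact ⟨u, rfl, hu, fun i => i.elim0⟩
  | succ n ih =>
    obtain ⟨v, hv, hvH, hvK⟩ := exists_ιMulti_eq_castSucc_mem (hK 0) u hu
    obtain ⟨w, hw, hwH, hwK⟩ := ih (H ⊓ K 0) (fun j => K (j + 1))
      (fun j a ha b hb => hK (j + 1) a ha.1 b hb.1) (fun i => v i.castSucc)
      fun i => ⟨hvH _, hvK i⟩
    refine ⟨Fin.snoc w (v (Fin.last n)), ?_, fun i => ?_, fun i => ?_⟩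
    · rw [hv, ιMulti_succ_last, ιMulti_succ_last, hw]
      simp
    · induction i using Fin.lastCases with
      | last => simpa using hvH _
      | cast i => simpa using (hwH i).1
    · induction i using Fin.lastCases with
      | last => intro j hj; simp at hj
      | cast i =>
        rintro (_ | j) hj
        · simpa using (hwH i).2
        · simpa using hwK i j (by simp at hj; omega)

end ExteriorAlgebra

/-- The additive group of units of `R` congruent to `1` modulo `I`. -/
def Ideal.congruenceUnits {R : Type*} [CommRing R] (I : Ideal R) : AddSubgroup (Additive Rˣ) :=
  (Units.map (Ideal.Quotient.mk I : R →* R ⧸ I)).ker.toAddSubgroup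

theorem Ideal.mem_congruenceUnits {R : Type*} [CommRing R] {I : Ideal R} {u : Additive Rˣ} :
    u ∈ I.congruenceUnits ↔ ((u.toMul : Rˣ) : R) - 1 ∈ I := by
  rw [← Ideal.Quotient.eq, map_one]
  exact Units.ext_iff

theorem Ideal.exists_natCast_sub_mem {R : Type*} [CommRing R] {P : Ideal R} {p : ℕ}
    (hp : p.Prime) (hP : Nat.card (R ⧸ P) = p) (x : R) : ∃ c : ℕ, (c : R) - x ∈ P := by
  have : Fact p.Prime := ⟨hp⟩
  have : Finite (R ⧸ P) := Nat.finite_of_card_ne_zero (hP ▸ hp.ne_zero)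
  have : Nontrivial (R ⧸ P) := Finite.one_lt_card_iff_nontrivial.mp (hP ▸ hp.one_lt)
  obtain ⟨c, hc⟩ := mem_multiples_of_prime_card hP (one_ne_zero (α := R ⧸ P))
    (g' := Ideal.Quotient.mk P x)
  refine ⟨c, Ideal.Quotient.eq.mp ?_⟩
  simpa using hc

theorem Ideal.pow_sub_one_sub_mul_mem_sq {R : Type*} [CommRing R] {P : Ideal R} {b : R}
    (hb : b - 1 ∈ P) (c : ℕ) : b ^ c - 1 - c * (b - 1) ∈ P ^ 2 := by
  induction c with
  | zero => simp
  | succ c ih =>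
    have h : b ^ (c + 1) - 1 - ((c + 1 : ℕ) : R) * (b - 1) =
        b * (b ^ c - 1 - c * (b - 1)) + c * (b - 1) ^ 2 := by
      push_cast; ring
    rw [h]
    exact add_mem (Ideal.mul_mem_left _ _ ih) (Ideal.mul_mem_left _ _ (Ideal.pow_mem_pow hb 2))

theorem Ideal.exists_add_zsmul_mem_congruenceUnits_sq {R : Type*} [CommRing R] [IsDedekindDomain R]
    {P : Ideal R} [P.IsPrime] (hP : P ≠ ⊥) {p : ℕ} (hp : p.Prime) (hcard : Nat.card (R ⧸ P) = p)
    {a b : Additive Rˣ} (ha : a ∈ P.congruenceUnits) (hb : b ∈ P.congruenceUnits)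
    (hb2 : b ∉ (P ^ 2).congruenceUnits) : ∃ c : ℤ, a + c • b ∈ (P ^ 2).congruenceUnits := by
  rw [mem_congruenceUnits] at ha hb hb2
  obtain ⟨d, e, he, hde⟩ := Ideal.exists_mul_add_mem_pow_succ (i := 1) hP _ _
    (by simpa using hb) hb2 (by simpa using ha)
  obtain ⟨c, hc⟩ := exists_natCast_sub_mem hp hcard (-d)
  refine ⟨c, ?_⟩
  rw [mem_congruenceUnits, natCast_zsmul, toMul_add, toMul_nsmul, Units.val_mul,
    Units.val_pow_eq_pow_val]
  generalize ((a.toMul : Rˣ) : R) = x at *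
  generalize ((b.toMul : Rˣ) : R) = y at *
  have h : x * y ^ c - 1 = x * (y ^ c - 1 - c * (y - 1)) + ((x - 1) * (c * (y - 1))
      + ((c - -d) * (y - 1) + e)) := by
    linear_combination -hde
  rw [h]
  have hmul {s t : R} (hs : s ∈ P) (ht : t ∈ P) : s * t ∈ P ^ 2 :=
    sq P ▸ Ideal.mul_mem_mul hs ht
  exact add_mem (Ideal.mul_mem_left _ _ (pow_sub_one_sub_mul_mem_sq hb c))
    (add_mem (hmul ha (Ideal.mul_mem_left _ _ hb)) (add_mem (hmul hc hb) he))


open NumberField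

/-- Let `E` be a number field, `p` an odd prime, and `P 0, …, P (s-1)`
(`s ≥ 1`) pairwise distinct maximal ideals of `𝓞 E` of norm `p`.  If `u 0, …, u (s-1)` are
units congruent to `1 mod P 0 ⋯ P (s-1)`, then there exist units `u' 0, …, u' (s-1)` with
`u 0 ∧ ⋯ ∧ u (s-1) = u' 0 ∧ ⋯ ∧ u' (s-1)` in the `s`-th exterior power over `ℤ` of the unit
group, and such that (in `1`-based indexing) `u'_k ≡ 1 mod P_1 ∏_{j=2}^{s+1-k} P_j² ∏_{j=s+2-k}^{s} P_j`;
here, in `0`-based indexing, the `k`-th modulus is `∏ j, P j ^ (2 if 1 ≤ j ≤ s-1-k, else 1)`.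
In particular `u' 0 ≡ 1 mod P_1 P_2² ⋯ P_s²` and `u' (s-1) ≡ 1 mod P_1 ⋯ P_s`. -/
theorem stmt4 (E : Type*) [Field E] [NumberField E]
    (p : ℕ) (hp : p.Prime) (hodd : Odd p)
    (s : ℕ) (hs : 1 ≤ s)
    (P : Fin s → Ideal (𝓞 E))
    (hPmax : ∀ i, (P i).IsMaximal)
    (hPnorm : ∀ i, Ideal.absNorm (P i) = p)
    (hPdist : Function.Injective P)
    (u : Fin s → (𝓞 E)ˣ)
    (hu : ∀ i, Ideal.Quotient.mk (∏ j, P j) ((u i : 𝓞 E)) = 1) :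
    ∃ u' : Fin s → (𝓞 E)ˣ,
      ExteriorAlgebra.ιMulti ℤ s (M := Additive (𝓞 E)ˣ) (fun i => Additive.ofMul (u i)) =
        ExteriorAlgebra.ιMulti ℤ s (M := Additive (𝓞 E)ˣ) (fun i => Additive.ofMul (u' i)) ∧
      ∀ k : Fin s,
        Ideal.Quotient.mk
            (∏ j, P j ^ (if 1 ≤ (j : ℕ) ∧ (j : ℕ) ≤ s - 1 - (k : ℕ) then 2 else 1))
            ((u' k : 𝓞 E)) = 1 := by
  have hprime i : (P i).IsPrime := (hPmax i).isPrime
  have hbot i : P i ≠ ⊥ := by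
    intro h
    have := hPnorm i
    rw [h, Ideal.absNorm_bot] at this
    exact hp.ne_zero this.symm
  let Q : ℕ → Ideal (𝓞 E) := fun j => if h : j + 1 < s then P ⟨j + 1, h⟩ else ⊤
  have hle i {x : 𝓞 E} (hx : x ∈ ∏ j, P j) : x ∈ P i :=
    Ideal.prod_le_inf.trans (Finset.inf_le (Finset.mem_univ i)) hx
  obtain ⟨w, hw, hwH, hwK⟩ := ExteriorAlgebra.exists_ιMulti_eq_triangular
    (∏ j, P j).congruenceUnits (fun j => (Q j ^ 2).congruenceUnits)
    (fun j a ha b hb hbK => by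
      rw [Ideal.mem_congruenceUnits] at ha hb
      by_cases h : j + 1 < s
      · simp only [Q, dif_pos h] at hbK ⊢
        have := hprime ⟨j + 1, h⟩
        exact Ideal.exists_add_zsmul_mem_congruenceUnits_sq (hbot _) hp (hPnorm _)
          (Ideal.mem_congruenceUnits.mpr (hle _ ha)) (Ideal.mem_congruenceUnits.mpr (hle _ hb)) hbK
      · simp [Q, dif_neg h, Ideal.mem_congruenceUnits, sq] at hbK)
    (fun i => Additive.ofMul (u i))
    (fun i => Ideal.mem_congruenceUnits.mpr <| Ideal.Quotient.eq.mp <| by simpa using hu i)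
  refine ⟨fun i => (w i).toMul, hw, fun k => ?_⟩
  rw [← map_one (Ideal.Quotient.mk _), Ideal.Quotient.eq,
    ← IsDedekindDomain.inf_pow_eq_prod_of_prime _ _ _
      (fun i _ => Ideal.prime_of_isPrime (hbot i) (hprime i))
      (fun i _ j _ hij => hPdist.ne hij), Submodule.mem_finsetInf]
  intro j _
  split_ifs with h
  · have hj : (j : ℕ) - 1 + 1 = j := by omega
    have hmem := Ideal.mem_congruenceUnits.mp (hwK k (j - 1) (by omega))
    have hs' : (j : ℕ) - 1 + 1 < s := by omega
    simpa only [Q, dif_pos hs', hj] using hmem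
  · rw [pow_one]
    exact hle j (Ideal.mem_congruenceUnits.mp (hwH k))
end

section
/- Let E be a number field, p an odd prime, s ≥ 1, and P_1,…,P_s pairwise distinct maximal ideals of 𝒪_E, each of norm p. Assume that every unit u of 𝒪_E with u ≡ 1 mod P_1 P_2² ⋯ P_s² satisfies u ≡ 1 mod P_1² P_2² ⋯ P_s². Then for all units u_1,…,u_s of 𝒪_E with u_i ≡ 1 mod P_1⋯P_s for all i, the image of u_1 ∧ ⋯ ∧ u_s under the map ⋀^s_ℤ(𝒪_E^×) → ⋀^s_ℤ((𝒪_E/P_1²⋯P_s²)^×) induced by reduction modulo P_1²⋯P_s² is zero; that is, u_1 ∧ ⋯ ∧ u_s is trivial mod P_1²⋯P_s². -/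
open NumberField

set_option synthInstance.maxHeartbeats 1000000

/-- An alternating map over `ℤ` vanishes on a family satisfying an integral relation in which the
coefficient of some `p`-torsion member is coprime to `p`. -/
theorem AlternatingMap.eq_zero_of_sum_zsmul_eq_zero {M N ι : Type*} [AddCommGroup M]
    [AddCommGroup N] [Fintype ι] [DecidableEq ι] (f : M [⋀^ι]→ₗ[ℤ] N) (v : ι → M) (m : ι → ℤ)
    (p : ℤ) (k : ι) (hm : ∑ i, m i • v i = 0) (hpv : p • v k = 0) (hk : IsCoprime p (m k)) :
    f v = 0 := by
  have hm_smul : m k • f v = 0 := by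
    have h : f (Function.update v k (∑ i, m i • v i)) = m k • f v := by
      rw [f.map_update_sum, Finset.sum_eq_single k]
      · rw [f.map_update_smul, Function.update_eq_self]
      · intro i _ hi
        rw [f.map_update_smul, f.map_update_self v hi.symm, smul_zero]
      · simp
    rw [← h, hm, f.map_update_zero]
  have hp_smul : p • f v = 0 := by
    rw [← Function.update_eq_self k v, ← f.map_update_smul, hpv, f.map_update_zero]
  obtain ⟨a, b, hab⟩ := hk
  rw [← one_smul ℤ (f v), ← hab, add_smul, mul_smul, mul_smul, hm_smul, hp_smul]
  simp

/-- If `p ∈ J` and `u ≡ 1 mod J`, then `u ^ p ≡ 1 mod J ^ 2`. -/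
theorem Ideal.pow_sub_one_mem_sq {R : Type*} [CommRing R] {J : Ideal R} {p : ℕ}
    (hp : (p : R) ∈ J) {u : R} (hu : u - 1 ∈ J) : u ^ p - 1 ∈ J ^ 2 := by
  have hgeom : ∑ i ∈ Finset.range p, u ^ i ∈ J := by
    rw [← Ideal.Quotient.eq_zero_iff_mem] at hp ⊢
    rw [← Ideal.Quotient.eq, map_one] at hu
    simpa [hu] using hp
  rw [← geom_sum_mul, sq]
  exact Ideal.mul_mem_mul hgeom hu

/-- If `I ≤ J` and `R ⧸ J` has `a` elements, `R ⧸ I` has `a * b` elements, then among more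
than `b` elements congruent to `1` mod `J`, two are congruent mod `I`. -/
theorem Ideal.exists_ne_quotient_mk_eq {R α : Type*} [CommRing R] [Finite α] {I J : Ideal R}
    (hIJ : I ≤ J) {a b : ℕ} (ha : 0 < a) (hb : 0 < b) (hJ : Nat.card (R ⧸ J) = a)
    (hI : Nat.card (R ⧸ I) = a * b) (x : α → R) (hx : ∀ i, Ideal.Quotient.mk J (x i) = 1)
    (hα : b < Nat.card α) :
    ∃ i j, i ≠ j ∧ Ideal.Quotient.mk I (x i) = Ideal.Quotient.mk I (x j) := by
  have : Finite (R ⧸ I) := Nat.finite_of_card_ne_zero (by rw [hI]; positivity)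
  let f : (R ⧸ I) →+ (R ⧸ J) := (Ideal.Quotient.factor hIJ).toAddMonoidHom
  have hf : Function.Surjective f := Ideal.Quotient.factor_surjective hIJ
  have hker : Nat.card f.ker = b := by
    have h := f.ker.card_mul_index
    rw [AddSubgroup.index_ker, AddMonoidHom.range_eq_top.mpr hf, AddSubgroup.card_top, hJ, hI,
      mul_comm] at h
    exact Nat.eq_of_mul_eq_mul_left ha h
  let g : α → f.ker := fun i => ⟨Ideal.Quotient.mk I (x i) - 1, by
    have h : Ideal.Quotient.factor hIJ (Ideal.Quotient.mk I (x i) - 1) = 0 := by simp [hx]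
    exact h⟩
  have hg : ¬ Function.Injective g := fun h =>
    (hα.trans_le (Nat.card_le_card_of_injective g h)).ne hker.symm
  simp only [Function.Injective, not_forall] at hg
  obtain ⟨i, j, hij, hne⟩ := hg
  exact ⟨i, j, hne, sub_left_injective (Subtype.ext_iff.mp hij)⟩

/-- Let `E` be a number field, `p` an odd prime, and `P 0, …, P (s-1)`
(`s ≥ 1`) pairwise distinct maximal ideals of `𝓞 E` of norm `p`.  Assume every unit
congruent to `1 mod P_1 P_2² ⋯ P_s²` is congruent to `1 mod P_1² P_2² ⋯ P_s²`.  Then for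
all units `u 0, …, u (s-1)` congruent to `1 mod P_1 ⋯ P_s`, the image of
`u 0 ∧ ⋯ ∧ u (s-1)` under the map on `s`-th exterior powers (over `ℤ`) induced by reduction
of units modulo `P_1² ⋯ P_s²` is zero. -/
theorem stmt5 (E : Type*) [Field E] [NumberField E]
    (p : ℕ) (hp : p.Prime) (hodd : Odd p)
    (s : ℕ) (hs : 1 ≤ s)
    (P : Fin s → Ideal (𝓞 E))
    (hPmax : ∀ i, (P i).IsMaximal)
    (hPnorm : ∀ i, Ideal.absNorm (P i) = p)
    (hPdist : Function.Injective P)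
    (hcong : ∀ u : (𝓞 E)ˣ,
      Ideal.Quotient.mk (∏ j, P j ^ (if (j : ℕ) = 0 then 1 else 2)) ((u : 𝓞 E)) = 1 →
      Ideal.Quotient.mk (∏ j, P j ^ 2) ((u : 𝓞 E)) = 1)
    (u : Fin s → (𝓞 E)ˣ)
    (hu : ∀ i, Ideal.Quotient.mk (∏ j, P j) ((u i : 𝓞 E)) = 1) :
    ExteriorAlgebra.map
        ((MonoidHom.toAdditive
          (Units.map (Ideal.Quotient.mk (∏ j, P j ^ 2)).toMonoidHom)).toIntLinearMap)
        (ExteriorAlgebra.ιMulti ℤ s (M := Additive (𝓞 E)ˣ)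
          (fun i => Additive.ofMul (u i))) = 0 := by
  classical
  set J := ∏ j, P j with hJ_def
  set I₁ := ∏ j, P j ^ (if (j : ℕ) = 0 then 1 else 2) with hI₁_def
  have hsq : ∏ j, P j ^ 2 = J ^ 2 := Finset.prod_pow _ _ _
  have hp_mem : (p : 𝓞 E) ∈ J := by
    have hcop : Pairwise (fun i j => IsCoprime (P i) (P j)) := fun i j hij =>
      Ideal.isCoprime_of_isMaximal (hPdist.ne hij)
    rw [hJ_def, Ideal.prod_eq_iInf_of_pairwise_isCoprime (fun i _ j _ hij => hcop hij)]
    simp only [Submodule.mem_iInf]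
    intro i _
    exact hPnorm i ▸ Ideal.absNorm_mem (P i)
  have hI₁J : I₁ ≤ J := Ideal.le_of_dvd (Finset.prod_dvd_prod_of_dvd _ _ fun j _ =>
    dvd_pow_self _ (by split_ifs <;> simp))
  have hcardJ : Nat.card (𝓞 E ⧸ J) = p ^ s := by
    change Ideal.absNorm J = _
    simp [hJ_def, map_prod, hPnorm]
  have hcardI₁ : Nat.card (𝓞 E ⧸ I₁) = p ^ s * p ^ (s - 1) := by
    change Ideal.absNorm I₁ = _
    obtain ⟨t, rfl⟩ := Nat.exists_eq_add_of_le' hs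
    rw [hI₁_def, Fin.prod_univ_succ]
    simp [map_prod, hPnorm]
    ring
  have hunit_mk : ∀ (I : Ideal (𝓞 E)) (w : (𝓞 E)ˣ), Ideal.Quotient.mk I (w : 𝓞 E) = 1 ↔
      Units.map (Ideal.Quotient.mk I).toMonoidHom w = 1 := fun I w => by
    rw [Units.ext_iff]; rfl
  obtain ⟨n, n', hne, hnn'⟩ := Ideal.exists_ne_quotient_mk_eq hI₁J (pow_pos hp.pos s)
    (pow_pos hp.pos (s - 1)) hcardJ hcardI₁
    (fun n : Fin s → Fin p => ((∏ i, u i ^ (n i : ℕ) : (𝓞 E)ˣ) : 𝓞 E))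
    (fun n => by simp [map_prod, hu])
    (by simpa using Nat.pow_lt_pow_right hp.one_lt (Nat.sub_lt hs one_pos))
  obtain ⟨k, hk⟩ := Function.ne_iff.mp hne
  rw [ExteriorAlgebra.map_apply_ιMulti]
  refine AlternatingMap.eq_zero_of_sum_zsmul_eq_zero _ _ (fun i => (n i : ℤ) - (n' i : ℤ)) p k
    ?_ ?_ ?_
  · have hrel := (hunit_mk I₁ ((∏ i, u i ^ (n i : ℕ)) / ∏ i, u i ^ (n' i : ℕ))).mpr (by
      rw [map_div, div_eq_one]
      exact Units.ext hnn')
    have hrel := (hunit_mk _ _).mp (hcong _ hrel)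
    rw [map_div, map_prod, map_prod, ← Finset.prod_div_distrib] at hrel
    apply Additive.toMul.injective
    rw [toMul_sum, toMul_zero, ← hrel]
    refine Finset.prod_congr rfl fun i _ => ?_
    rw [map_pow, map_pow, ← zpow_natCast, ← zpow_natCast, div_eq_mul_inv, ← zpow_sub]
    rfl
  · have h := Ideal.pow_sub_one_mem_sq hp_mem (Ideal.Quotient.eq.mp ((hu k).trans (map_one _).symm))
    rw [← hsq, ← Ideal.Quotient.eq, map_one, ← Units.val_pow_eq_pow_val, hunit_mk, map_pow,
      ← zpow_natCast] at h
    exact h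
  · rw [(Nat.prime_iff_prime_int.mp hp).coprime_iff_not_dvd]
    intro hdvd
    have := Int.eq_zero_of_abs_lt_dvd hdvd (by rw [abs_lt]; omega)
    exact hk (Fin.ext (by omega))
end

section
/- Let E be a number field, p an odd prime, 1 ≤ s ≤ g, and P_1,…,P_g pairwise distinct maximal ideals of 𝒪_E, each of norm p. Assume that every unit u of 𝒪_E with u ≡ 1 mod P_1 P_2² ⋯ P_s² satisfies u ≡ 1 mod P_1² P_2² ⋯ P_s². Then for all units u_1,…,u_g of 𝒪_E with u_i ≡ 1 mod P_1⋯P_g for all i, the image of u_1 ∧ ⋯ ∧ u_g under the map ⋀^g_ℤ(𝒪_E^×) → ⋀^g_ℤ((𝒪_E/P_1²⋯P_g²)^×) induced by reduction modulo P_1²⋯P_g² is zero; that is, u_1 ∧ ⋯ ∧ u_g is trivial mod P_1²⋯P_g². -/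
open NumberField

set_option synthInstance.maxHeartbeats 1000000

/-- An alternating map vanishes on a family of vectors killed by `p` which satisfies a linear
relation with a coefficient prime to `p`. -/
theorem AlternatingMap.eq_zero_of_sum_nsmul_eq_zero {ι M N : Type*} [Fintype ι]
    [AddCommGroup M] [AddCommGroup N] (f : M [⋀^ι]→ₗ[ℤ] N) (v : ι → M) (p : ℕ) (c : ι → ℕ) (i : ι)
    (hpv : p • v i = 0) (hc : ∑ j, c j • v j = 0) (hi : (c i).Coprime p) : f v = 0 := by
  classical
  have hsmul (n : ℕ) (j : ι) :
      f (Function.update v i (n • v j)) = n • f (Function.update v i (v j)) := by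
    rw [← natCast_zsmul, f.map_update_smul, natCast_zsmul]
  have h1 : p • f v = 0 := by
    have := hsmul p i
    rwa [hpv, f.map_update_zero, Function.update_eq_self, eq_comm] at this
  have h2 : c i • f v = 0 := by
    have h0 : f (Function.update v i (∑ j, c j • v j)) = 0 := by rw [hc, f.map_update_zero]
    rw [f.map_update_sum, Finset.sum_eq_single i] at h0
    · rwa [hsmul, Function.update_eq_self] at h0
    · intro j _ hj
      rw [hsmul, f.map_update_self v hj.symm, smul_zero]
    · simp
  have h3 := Nat.dvd_gcd (addOrderOf_dvd_of_nsmul_eq_zero h2) (addOrderOf_dvd_of_nsmul_eq_zero h1)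
  rwa [hi.gcd_eq_one, Nat.dvd_one, AddMonoid.addOrderOf_eq_one_iff] at h3

theorem sub_one_mem_of_mem_ker_unitsMap {R : Type*} [CommRing R] {I : Ideal R}
    (u : (Units.map (Ideal.Quotient.mk I).toMonoidHom).ker) : ((u : Rˣ) : R) - 1 ∈ I := by
  have h := congrArg Units.val (MonoidHom.mem_ker.mp u.2)
  exact Ideal.Quotient.eq.mp (h.trans (map_one (Ideal.Quotient.mk I)).symm)

/-- The homomorphism `u ↦ u - 1` from the units congruent to `1` modulo `I` to `I / I ^ 2`. -/
def unitsToCotangent {R : Type*} [CommRing R] (I : Ideal R) :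
    (Units.map (Ideal.Quotient.mk I).toMonoidHom).ker →* Multiplicative I.Cotangent where
  toFun u := Multiplicative.ofAdd (I.toCotangent ⟨(u : Rˣ) - 1,
    sub_one_mem_of_mem_ker_unitsMap u⟩)
  map_one' := by
    rw [ofAdd_eq_one, Ideal.toCotangent_eq_zero]
    simp
  map_mul' u v := by
    rw [← ofAdd_add, ← map_add]
    congr 1
    rw [Ideal.toCotangent_eq]
    rw [pow_two]
    convert Ideal.mul_mem_mul (sub_one_mem_of_mem_ker_unitsMap u)
      (sub_one_mem_of_mem_ker_unitsMap v) using 1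
    simp only [Subgroup.coe_mul, Units.val_mul, Submodule.coe_add]
    ring

theorem unitsToCotangent_eq_one_iff {R : Type*} [CommRing R] {I : Ideal R}
    (u : (Units.map (Ideal.Quotient.mk I).toMonoidHom).ker) :
    unitsToCotangent I u = 1 ↔
      Units.map (Ideal.Quotient.mk (I ^ 2)).toMonoidHom (u : Rˣ) = 1 := by
  change Multiplicative.ofAdd _ = 1 ↔ _
  rw [ofAdd_eq_one, Ideal.toCotangent_eq_zero, Units.ext_iff]
  exact (Ideal.Quotient.eq (I := I ^ 2) (x := ((u : Rˣ) : R)) (y := 1)).symm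

theorem Ideal.natCard_cotangent {R : Type*} [CommRing R] [IsDedekindDomain R] [Module.Free ℤ R]
    [Module.Finite ℤ R] [CharZero R] {I : Ideal R} (hI : I ≠ ⊥) :
    Nat.card I.Cotangent = Ideal.absNorm I := by
  have h1 := Submodule.card_eq_card_quotient_mul_card I.cotangentIdeal
  rw [Nat.card_congr I.quotCotangent.toEquiv, ← Nat.card_congr I.cotangentEquivIdeal.toEquiv] at h1
  have h2 : Ideal.absNorm (I ^ 2) = Nat.card (R ⧸ I ^ 2) := by
    rw [Ideal.absNorm_apply, Submodule.cardQuot_apply]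
  have h3 : Ideal.absNorm I = Nat.card (R ⧸ I) := by
    rw [Ideal.absNorm_apply, Submodule.cardQuot_apply]
  rw [← h2, map_pow, ← h3, pow_two] at h1
  have h4 : Ideal.absNorm I ≠ 0 := by
    rwa [Ne, Ideal.absNorm_eq_zero_iff]
  have h5 : Ideal.absNorm I * Ideal.absNorm I = Ideal.absNorm I * Nat.card I.Cotangent := by
    rw [h1, mul_comm]
  exact (Nat.eq_of_mul_eq_mul_left (Nat.pos_of_ne_zero h4) h5).symm

/-- In an elementary abelian `p`-group of order `p ^ n`, a family of `n` elements either satisfies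
a linear relation with a coefficient prime to `p`, or generates the group. -/
theorem exists_sum_nsmul_eq_zero_or_forall_exists_sum_nsmul_eq {A : Type*} [AddCommGroup A]
    {p n : ℕ} [Fact p.Prime] [Module (ZMod p) A] (hcard : Nat.card A = p ^ n)
    (w : Fin n → A) :
    (∃ c : Fin n → ℕ, ∑ i, c i • w i = 0 ∧ ∃ i, (c i).Coprime p) ∨
      ∀ a : A, ∃ c : Fin n → ℕ, ∑ i, c i • w i = a := by
  have hp : p.Prime := Fact.out
  have _ : Finite A := Nat.finite_of_card_ne_zero (by rw [hcard]; exact pow_ne_zero _ hp.ne_zero)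
  have hval (a : ZMod p) (x : A) : a.val • x = a • x := by
    rw [← Nat.cast_smul_eq_nsmul (ZMod p), ZMod.natCast_zmod_val]
  have hrank : Fintype.card (Fin n) = Module.finrank (ZMod p) A := by
    have h := FiniteField.pow_finrank_eq_natCard p A
    rw [hcard] at h
    rw [Fintype.card_fin, Nat.pow_right_injective hp.two_le h]
  by_cases hw : LinearIndependent (ZMod p) w
  · right
    intro a
    have ha : a ∈ Submodule.span (ZMod p) (Set.range w) := by
      rw [hw.span_eq_top_of_card_eq_finrank' hrank]
      exact Submodule.mem_top
    obtain ⟨c, hc⟩ := (Submodule.mem_span_range_iff_exists_fun _).mp ha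
    exact ⟨fun i ↦ (c i).val, by simp only [hval, hc]⟩
  · left
    obtain ⟨c, hc, i, hi⟩ := Fintype.not_linearIndependent_iff.mp hw
    refine ⟨fun i ↦ (c i).val, by simp only [hval, hc], i, ?_⟩
    refine Nat.Coprime.symm ((hp.coprime_iff_not_dvd).mpr fun h ↦ hi ?_)
    rw [← ZMod.natCast_zmod_val (c i), (ZMod.natCast_eq_zero_iff _ _).mpr h]

/-- If a unit congruent to `1` modulo `Q * A` is automatically congruent to `1` modulo `Q ^ 2`,
then the units congruent to `1` modulo `I` do not surject onto `I / I ^ 2`, where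
`I ^ 2 = Q ^ 2 * A`. -/
theorem not_surjective_unitsToCotangent {R : Type*} [CommRing R] [IsDedekindDomain R]
    {I Q A : Ideal R} (hI : I ^ 2 = Q ^ 2 * A) (hQ : Q ≠ ⊥) (hQ' : Q ≠ ⊤) (hA : A ≠ ⊥)
    (hQA : IsCoprime (Q ^ 2) A) (hle : Q * A ≤ I)
    (h : ∀ u : Rˣ, (u : R) - 1 ∈ Q * A → (u : R) - 1 ∈ Q ^ 2) :
    ¬ Function.Surjective (unitsToCotangent I) := by
  intro hsurj
  have hlt : ¬ Q * A ≤ I ^ 2 := by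
    intro hle'
    have heq : Q * A * Q = Q * A * 1 := by
      rw [mul_one]
      refine le_antisymm Ideal.mul_le_left ?_
      rw [hI] at hle'
      exact hle'.trans_eq (by ring)
    exact hQ' (by simpa using mul_left_cancel₀ (mul_ne_zero hQ hA) heq)
  obtain ⟨x, hx, hx'⟩ := SetLike.not_le_iff_exists.mp hlt
  obtain ⟨u, hu⟩ := hsurj (Multiplicative.ofAdd (I.toCotangent ⟨x, hle hx⟩))
  have hux : ((u : Rˣ) : R) - 1 - x ∈ I ^ 2 :=
    (Ideal.toCotangent_eq I).mp (Multiplicative.ofAdd.injective hu)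
  have hIle : I ^ 2 ≤ Q * A := by
    rw [hI, pow_two, mul_assoc]
    exact Ideal.mul_le_right
  have huQA : ((u : Rˣ) : R) - 1 ∈ Q * A := by
    simpa using add_mem (hIle hux) hx
  have huI : ((u : Rˣ) : R) - 1 ∈ I ^ 2 := by
    rw [hI, Ideal.mul_eq_inf_of_isCoprime hQA]
    exact Ideal.mem_inf.mpr ⟨h u huQA, Ideal.mul_le_right huQA⟩
  exact hx' (by simpa using sub_mem huI hux)

/-- Let `E` be a number field, `p` an odd prime, `1 ≤ s ≤ g`, and
`P 0, …, P (g-1)` pairwise distinct maximal ideals of `𝓞 E` of norm `p`.  Assume every unit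
congruent to `1 mod P_1 P_2² ⋯ P_s²` is congruent to `1 mod P_1² P_2² ⋯ P_s²`.  Then for
all units `u 0, …, u (g-1)` congruent to `1 mod P_1 ⋯ P_g`, the image of
`u 0 ∧ ⋯ ∧ u (g-1)` under the map on `g`-th exterior powers (over `ℤ`) induced by reduction
of units modulo `P_1² ⋯ P_g²` is zero. -/
theorem stmt6 (E : Type*) [Field E] [NumberField E]
    (p : ℕ) (hp : p.Prime) (hodd : Odd p)
    (s g : ℕ) (hs : 1 ≤ s) (hsg : s ≤ g)
    (P : Fin g → Ideal (𝓞 E))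
    (hPmax : ∀ i, (P i).IsMaximal)
    (hPnorm : ∀ i, Ideal.absNorm (P i) = p)
    (hPdist : Function.Injective P)
    (hcong : ∀ u : (𝓞 E)ˣ,
      Ideal.Quotient.mk
          (∏ j, P j ^ (if (j : ℕ) = 0 then 1 else if (j : ℕ) < s then 2 else 0))
          ((u : 𝓞 E)) = 1 →
      Ideal.Quotient.mk (∏ j, P j ^ (if (j : ℕ) < s then 2 else 0)) ((u : 𝓞 E)) = 1)
    (u : Fin g → (𝓞 E)ˣ)
    (hu : ∀ i, Ideal.Quotient.mk (∏ j, P j) ((u i : 𝓞 E)) = 1) :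
    ExteriorAlgebra.map
        ((MonoidHom.toAdditive
          (Units.map (Ideal.Quotient.mk (∏ j, P j ^ 2)).toMonoidHom)).toIntLinearMap)
        (ExteriorAlgebra.ιMulti ℤ g (M := Additive (𝓞 E)ˣ)
          (fun i => Additive.ofMul (u i))) = 0 := by
  have hprime (i) : (P i).IsPrime := (hPmax i).isPrime
  have hpP (i) : (p : 𝓞 E) ∈ P i := hPnorm i ▸ Ideal.absNorm_mem (P i)
  have hP0 (i) : P i ≠ ⊥ := by
    intro h
    have := hPnorm i
    rw [h, Ideal.absNorm_bot] at this
    exact hp.ne_zero this.symm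
  have hPcop {i j} (hij : i ≠ j) : IsCoprime (P i) (P j) :=
    Ideal.isCoprime_iff_sup_eq.mpr
      ((hPmax i).coprime_of_ne (hPmax j) fun h ↦ hij (hPdist h))
  rw [Finset.prod_pow]
  set I := ∏ j, P j with hIdef
  have hI0 : I ≠ ⊥ := Finset.prod_ne_zero_iff.mpr fun i _ ↦ hP0 i
  have hpI : (p : 𝓞 E) ∈ I := by
    rw [hIdef, Ideal.prod_eq_iInf_of_pairwise_isCoprime fun i _ j _ hij ↦ hPcop hij]
    simpa using hpP
  have hker (i) : u i ∈ (Units.map (Ideal.Quotient.mk I).toMonoidHom).ker := by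
    rw [MonoidHom.mem_ker, Units.ext_iff]
    exact hu i
  set L := (MonoidHom.toAdditive
    (Units.map (Ideal.Quotient.mk (I ^ 2)).toMonoidHom)).toIntLinearMap
  let w (i : Fin g) : I.Cotangent := (unitsToCotangent I ⟨u i, hker i⟩).toAdd
  have hpC (a : I.Cotangent) : p • a = 0 := by
    rw [← Nat.cast_smul_eq_nsmul (𝓞 E)]
    exact Ideal.Cotangent.smul_eq_zero_of_mem hpI a
  have _ : Fact p.Prime := ⟨hp⟩
  let _ : Module (ZMod p) I.Cotangent := AddCommGroup.zmodModule hpC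
  have hcard : Nat.card I.Cotangent = p ^ g := by
    rw [Ideal.natCard_cotangent hI0, hIdef, map_prod]
    simp [hPnorm]
  have hw (c : Fin g → ℕ) : unitsToCotangent I (∏ i, ⟨u i, hker i⟩ ^ c i) =
      Multiplicative.ofAdd (∑ i, c i • w i) := by
    rw [map_prod]
    simp only [map_pow, ofAdd_sum, ofAdd_nsmul, w, ofAdd_toAdd]
  rw [ExteriorAlgebra.map_apply_ιMulti]
  obtain ⟨c, hc, i, hi⟩ | hgen :=
    exists_sum_nsmul_eq_zero_or_forall_exists_sum_nsmul_eq (p := p) hcard w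
  · refine AlternatingMap.eq_zero_of_sum_nsmul_eq_zero _ _ p c i ?_ ?_ hi
    · have h := (unitsToCotangent_eq_one_iff (⟨u i, hker i⟩ ^ p)).mp
        (by rw [map_pow]; exact hpC (w i))
      rw [Subgroup.coe_pow, map_pow] at h
      exact h
    · have h := (unitsToCotangent_eq_one_iff (∏ i, ⟨u i, hker i⟩ ^ c i)).mp
        (by rw [hw, hc, ofAdd_zero])
      simp only [Subgroup.val_finsetProd, Subgroup.coe_pow, map_prod, map_pow] at h
      exact h
  · obtain ⟨n, rfl⟩ : ∃ n, g = n + 1 := ⟨g - 1, by omega⟩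
    refine absurd (fun a ↦ ?_) (not_surjective_unitsToCotangent (I := I) (Q := P 0)
      (A := ∏ i : Fin n, P i.succ ^ 2) ?_ (hP0 0) (hprime 0).ne_top ?_ ?_ ?_ ?_)
    · obtain ⟨c, hc⟩ := hgen a.toAdd
      exact ⟨_, (hw c).trans (by rw [hc, ofAdd_toAdd])⟩
    · rw [hIdef, Fin.prod_univ_succ, mul_pow, Finset.prod_pow]
    · exact Finset.prod_ne_zero_iff.mpr fun i _ ↦ pow_ne_zero 2 (hP0 _)
    · exact IsCoprime.prod_right fun i _ ↦ (hPcop (Fin.succ_ne_zero i).symm).pow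
    · rw [hIdef, Fin.prod_univ_succ]
      exact Ideal.mul_mono_right (Finset.prod_le_prod' fun i _ ↦ Ideal.pow_le_self two_ne_zero)
    · intro v hv
      have h := hcong v (Ideal.Quotient.eq.mpr ?_)
      · have h := Ideal.Quotient.eq.mp (h.trans (map_one _).symm)
        rw [Fin.prod_univ_succ] at h
        have h := Ideal.mul_le_left h
        rwa [if_pos (by simpa using Nat.pos_of_ne_zero (by omega))] at h
      · refine SetLike.le_def.mp ?_ hv
        rw [Fin.prod_univ_succ]
        refine Ideal.mul_mono (by simp) (Finset.prod_le_prod' fun i _ ↦ ?_)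
        refine Ideal.pow_le_pow_right ?_
        split_ifs <;> simp
end
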